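/- arXiv:math/9912142 — 2 statements merged into one kernel-verified Lean document; each statement's English description precedes it below -/
import Mathlib

section
/- Define the triple sums S_A = Σ_{z1,z2,z3} (−1)^(z1+z2+z3) · [(g−h+k+z1)!(a+c−h+z1)!(2h−z1)! / (z1!(g+h−k−z1)!(c−a+h−z1)!)] · [(2d−z2)!(c−d+f+z2)! / (z2!(d−b+k−z2)!(c+d−f−z2)!(b+d+k+1−z2)!)] · [(b+e−a+z3)!(e−f+g+z3)! / (z3!(a+b−e−z3)!(f+g−e−z3)!(2e+1+z3)!)] · [(a+d−e+k−z2−z3)! / ((a−d+f−h+z1+z2)!(e−f−h+k+z1+z3)!)] and S_X = Σ_{z1,z2,z3} (−1)^(z1+z2+z3) · [(g−h+k+z1)!(g+h+k+1+z1)! / (z1!(g+k−a−c+z1)!(c+g+k−a+1+z1)!(2g+1+z1)!)] · [(2b−z2)!(b+f+k−c−z2)!(b+c+f+k+1−z2)! / (z2!(b+k−d−z2)!(b+d+k+1−z2)!)] · [(b+e−a+z3)!(e−f+g+z3)! / (z3!(a+b−e−z3)!(f+g−e−z3)!(2e+1+z3)!)] · [(f+g−e+z1−z3)! / ((a+b+f−g−z1−z2)!(b+e−a−z2+z3)!)].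 Then, under the triangle conditions of the 9j symbol, (−1)^(c+h−a) · S_A = (−1)^(a+c−h) · S_X (both exponents are integers). This expresses the equality of the Ališauskas–Jucys triple-sum formula for the SU(2) 9j coefficient {a b e; c d f; h k g} and the new triple-sum formula (with only partial triangle restrictions of the summation intervals) obtained from expansion (vrx6a) of the paper. -/
noncomputable section

/-- Factorial of a rational argument: `x!` when `x` is a nonnegative integer,
and `0` otherwise.  Terms of a sum containing a factorial with an invalid
argument are thereby omitted: in the numerator such a factor is `0`, and in the
denominator it produces a division by zero, which is `0` in `ℚ`. -/
def fct (x : ℚ) : ℚ :=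
  if 0 ≤ x ∧ x.den = 1 then (Nat.factorial x.num.toNat : ℚ) else 0

/-- `(-1)` raised to a rational exponent (an integer whenever it matters). -/
def neg1pw (x : ℚ) : ℚ := (-1 : ℚ) ^ x.num

/-- `x` is a nonnegative half-integer. -/
def IsNNHalfInt (x : ℚ) : Prop := 0 ≤ x ∧ ∃ m : ℤ, 2 * x = (m : ℚ)

/-- The triangle condition for the triad `(x, y, z)`: the linear combinations
`x+y-z`, `x-y+z` and `-x+y+z` are all nonnegative integers. -/
def Triad (x y z : ℚ) : Prop :=
  (∃ n : ℕ, x + y - z = (n : ℚ)) ∧ (∃ n : ℕ, x - y + z = (n : ℚ)) ∧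
    (∃ n : ℕ, -x + y + z = (n : ℚ))

/-- The square `N(x,y,z)` of the asymmetric triangle coefficient `∇[xyz]`. -/
def Nsq (x y z : ℚ) : ℚ :=
  fct (x + y - z) * fct (x - y + z) * fct (x + y + z + 1) / fct (y + z - x)

/-- The Ališauskas–Jucys triple sum `S_A` for the 9j coefficient. -/
def sumSA (a b c d e f g h k : ℚ) : ℚ :=
  ∑ᶠ z1 : ℕ, ∑ᶠ z2 : ℕ, ∑ᶠ z3 : ℕ,
    (-1 : ℚ) ^ (z1 + z2 + z3) *
      (fct (g - h + k + z1) * fct (a + c - h + z1) * fct (2 * h - z1) /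
        ((Nat.factorial z1 : ℚ) * fct (g + h - k - z1) * fct (c - a + h - z1))) *
      (fct (2 * d - z2) * fct (c - d + f + z2) /
        ((Nat.factorial z2 : ℚ) * fct (d - b + k - z2) * fct (c + d - f - z2) *
          fct (b + d + k + 1 - z2))) *
      (fct (b + e - a + z3) * fct (e - f + g + z3) /
        ((Nat.factorial z3 : ℚ) * fct (a + b - e - z3) * fct (f + g - e - z3) *
          fct (2 * e + 1 + z3))) *
      (fct (a + d - e + k - z2 - z3) /
        (fct (a - d + f - h + z1 + z2) * fct (e - f - h + k + z1 + z3)))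

/-- The triple sum `S_X` of the new triple-sum formula (with only partial
triangle restrictions of the summation intervals) obtained from expansion
(vrx6a) of the paper. -/
def sumSX (a b c d e f g h k : ℚ) : ℚ :=
  ∑ᶠ z1 : ℕ, ∑ᶠ z2 : ℕ, ∑ᶠ z3 : ℕ,
    (-1 : ℚ) ^ (z1 + z2 + z3) *
      (fct (g - h + k + z1) * fct (g + h + k + 1 + z1) /
        ((Nat.factorial z1 : ℚ) * fct (g + k - a - c + z1) *
          fct (c + g + k - a + 1 + z1) * fct (2 * g + 1 + z1))) *
      (fct (2 * b - z2) * fct (b + f + k - c - z2) * fct (b + c + f + k + 1 - z2) /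
        ((Nat.factorial z2 : ℚ) * fct (b + k - d - z2) * fct (b + d + k + 1 - z2))) *
      (fct (b + e - a + z3) * fct (e - f + g + z3) /
        ((Nat.factorial z3 : ℚ) * fct (a + b - e - z3) * fct (f + g - e - z3) *
          fct (2 * e + 1 + z3))) *
      (fct (f + g - e + z1 - z3) /
        (fct (a + b + f - g - z1 - z2) * fct (b + e - a - z2 + z3)))

/-- The factorial on `ℤ`, extended by `0` to negative integers. -/
def ff (n : ℤ) : ℚ := if 0 ≤ n then (Nat.factorial n.toNat : ℚ) else 0

/-- The inverse factorial on `ℤ`, vanishing on negative integers. -/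
def rf (n : ℤ) : ℚ := (ff n)⁻¹

lemma ff_neg {n : ℤ} (h : n < 0) : ff n = 0 := if_neg (not_le.mpr h)

lemma ff_natCast (n : ℕ) : ff (n : ℤ) = (Nat.factorial n : ℚ) := by simp [ff]

lemma ff_ne_zero {n : ℤ} (h : 0 ≤ n) : ff n ≠ 0 := by
  lift n to ℕ using h
  rw [ff_natCast]
  positivity

lemma rf_neg {n : ℤ} (h : n < 0) : rf n = 0 := by rw [rf, ff_neg h, inv_zero]

lemma nonneg_of_rf {n : ℤ} (h : rf n ≠ 0) : 0 ≤ n := by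
  by_contra hn
  exact h (rf_neg (not_le.mp hn))

lemma ff_mul_rf {n : ℤ} (h : 0 ≤ n) : ff n * rf n = 1 := mul_inv_cancel₀ (ff_ne_zero h)

lemma ff_add_one {n : ℤ} (h : 0 ≤ n) : ff (n + 1) = (n + 1) * ff n := by
  lift n to ℕ using h
  rw [ff_natCast, ← Nat.cast_succ, ff_natCast, Nat.factorial_succ]
  push_cast
  ring

lemma rf_sub_one (n : ℤ) : rf (n - 1) = n * rf n := by
  rcases lt_trichotomy n 0 with h | rfl | h
  · rw [rf_neg h, rf_neg (by omega), mul_zero]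
  · rw [rf_neg (by omega)]
    simp
  · have h1 := ff_add_one (n := n - 1) (by omega)
    have h2 := ff_ne_zero (n := n - 1) (by omega)
    have h3 : (n : ℚ) ≠ 0 := by exact_mod_cast h.ne'
    rw [sub_add_cancel] at h1
    rw [rf, rf, h1]
    push_cast
    rw [sub_add_cancel, mul_inv, ← mul_assoc, mul_inv_cancel₀ h3, one_mul]

lemma fct_intCast (n : ℤ) : fct (n : ℚ) = ff n := by simp [fct, ff]

/-- The falling factorial at an integer, through factorials on either side of zero. -/
lemma descPochhammer_eval_intCast (q : ℕ) (n : ℤ) :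
    (descPochhammer ℚ q).eval (n : ℚ) =
      ff n * rf (n - q) + (-1) ^ q * (ff (q - n - 1) * rf (-n - 1)) := by
  induction q with
  | zero =>
    rcases le_or_gt 0 n with h | h
    · rw [rf_neg (n := -n - 1) (by omega)]
      simp [ff_mul_rf h]
    · rw [ff_neg h, Nat.cast_zero, zero_sub, ff_mul_rf (by omega)]
      simp
  | succ q ih =>
    rw [descPochhammer_succ_eval, ih]
    rcases le_or_gt 0 n with h | h
    · rw [rf_neg (n := -n - 1) (by omega)]
      have := rf_sub_one (n - q)
      rw [Nat.cast_succ, ← sub_sub, this]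
      push_cast
      ring
    · rw [ff_neg h]
      have := ff_add_one (n := (q : ℤ) - n - 1) (by omega)
      rw [Nat.cast_succ, show (q : ℤ) + 1 - n - 1 = (q : ℤ) - n - 1 + 1 by ring, this]
      push_cast
      ring

/-- The alternating binomial sum of a polynomial of small degree vanishes. -/
lemma sum_neg_one_pow_mul_eval_eq_zero (P : Polynomial ℚ) (M : ℕ) (h : P.natDegree < M) :
    ∑ i ∈ Finset.range (M + 1), (-1 : ℚ) ^ i * (rf i * rf (M - i)) * P.eval (i : ℚ) = 0 := by
  have h1 := congrFun (Polynomial.fwdDiff_iter_eq_zero_of_degree_lt h) 0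
  rw [fwdDiff_iter_eq_sum_shift] at h1
  have h2 : ∑ i ∈ Finset.range (M + 1), (-1 : ℚ) ^ i * (rf i * rf (M - i)) * P.eval (i : ℚ) =
      (-1) ^ M * (Nat.factorial M : ℚ)⁻¹ * ∑ k ∈ Finset.range (M + 1),
        ((-1 : ℤ) ^ (M - k) * M.choose k) • P.eval (0 + k • (1 : ℚ)) := by
    rw [Finset.mul_sum]
    refine Finset.sum_congr rfl fun i hi => ?_
    have hi' : i ≤ M := by simpa [Nat.lt_succ_iff] using hi
    have hs : (-1 : ℚ) ^ M = (-1) ^ (M - i) * (-1) ^ i := by rw [← pow_add]; congr 1; omega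
    have hs2 : (-1 : ℚ) ^ (M - i) * (-1) ^ (M - i) = 1 := by rw [← mul_pow]; simp
    rw [rf, rf, ← Nat.cast_sub hi', ff_natCast, ff_natCast, hs]
    simp only [zsmul_eq_mul, nsmul_eq_mul, mul_one, zero_add]
    push_cast
    rw [Nat.cast_choose ℚ hi']
    have := Nat.factorial_ne_zero M
    have := Nat.factorial_ne_zero i
    have := Nat.factorial_ne_zero (M - i)
    field_simp
    linear_combination (-P.eval (i : ℚ)) * hs2
  rw [h2, h1]
  simp

/-- Reflection of a terminating balanced hypergeometric sum, from the vanishing of an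
alternating binomial sum of a product of three falling factorials. -/
lemma sum_reflection (p q r : ℕ) (u v y : ℤ) (hu : 0 ≤ u + p) (hv : v ≤ y + r) (hy : y ≤ v + q) :
    ∑ i ∈ Finset.range (p + q + r + 2), (-1 : ℚ) ^ i * (rf i * rf ((p + q + r + 1 : ℕ) - i)) *
        (ff (i + u + p) * rf (i + u) * (ff (v + q - i) * rf (v - i)) *
          (ff (y + r - i) * rf (y - i))) =
      -((-1) ^ (q + r) * ∑ i ∈ Finset.range (p + q + r + 2),
        (-1 : ℚ) ^ i * (rf i * rf ((p + q + r + 1 : ℕ) - i)) *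
        (ff (i + u + p) * rf (i + u) * (ff (i - v - 1) * rf (i - v - q - 1)) *
          (ff (i - y - 1) * rf (i - y - r - 1)))) := by
  have key := sum_neg_one_pow_mul_eval_eq_zero
    ((descPochhammer ℚ p).comp (Polynomial.X + Polynomial.C ((u + p : ℤ) : ℚ)) *
      (descPochhammer ℚ q).comp (Polynomial.C ((v + q : ℤ) : ℚ) - Polynomial.X) *
      (descPochhammer ℚ r).comp (Polynomial.C ((y + r : ℤ) : ℚ) - Polynomial.X)) (p + q + r + 1) (by
      refine Nat.lt_succ_of_le ?_
      refine Polynomial.natDegree_mul_le.trans (add_le_add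
        (Polynomial.natDegree_mul_le.trans (add_le_add ?_ ?_)) ?_) <;>
      · refine Polynomial.natDegree_comp_le.trans ?_
        rw [descPochhammer_natDegree]
        refine (Nat.mul_le_mul_left _ ?_).trans (mul_one _).le
        compute_degree)
  rw [eq_neg_iff_add_eq_zero, Finset.mul_sum, ← Finset.sum_add_distrib, ← key]
  refine Finset.sum_congr rfl fun i _ => ?_
  simp only [Polynomial.eval_mul, Polynomial.eval_comp, Polynomial.eval_add, Polynomial.eval_sub,
    Polynomial.eval_X, Polynomial.eval_C]
  have e1 := descPochhammer_eval_intCast p (i + (u + p))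
  have e2 := descPochhammer_eval_intCast q (v + q - i)
  have e3 := descPochhammer_eval_intCast r (y + r - i)
  rw [rf_neg (n := -(i + (u + p)) - 1) (by omega)] at e1
  have c1 : rf (v - i) * rf (i - y - r - 1) = 0 := by
    rcases le_or_gt (i : ℤ) v with h | h
    · rw [rf_neg (n := i - y - r - 1) (by omega), mul_zero]
    · rw [rf_neg (by omega), zero_mul]
  have c2 : rf (y - i) * rf (i - v - q - 1) = 0 := by
    rcases le_or_gt (i : ℤ) y with h | h
    · rw [rf_neg (n := i - v - q - 1) (by omega), mul_zero]
    · rw [rf_neg (by omega), zero_mul]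
  push_cast at e1 e2 e3 ⊢
  rw [e1, e2, e3]
  simp only [show (i : ℤ) + (u + p) = i + u + p by ring, show (i : ℤ) + u + p - p = i + u by ring,
    show v + q - i - q = v - i by ring, show y + r - i - r = y - i by ring,
    show (q : ℤ) - (v + q - i) - 1 = i - v - 1 by ring,
    show (r : ℤ) - (y + r - i) - 1 = i - y - 1 by ring,
    show -(v + q - i) - 1 = i - v - q - 1 by ring,
    show -(y + r - i) - 1 = i - y - r - 1 by ring]
  rw [pow_add]
  linear_combination
    (-(-1 : ℚ) ^ i * (rf i * rf (p + q + r + 1 - i)) * (ff (i + u + p) * rf (i + u)) * (-1) ^ r *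
      ff (v + q - i) * ff (i - y - 1)) * c1 +
    (-(-1 : ℚ) ^ i * (rf i * rf (p + q + r + 1 - i)) * (ff (i + u + p) * rf (i + u)) * (-1) ^ q *
      ff (y + r - i) * ff (i - v - 1)) * c2

lemma sum_range_eq_finsum (f : ℤ → ℚ) (B : ℕ) (hf : ∀ z, f z ≠ 0 → 0 ≤ z ∧ z < B) :
    ∑ z ∈ Finset.range B, f z = ∑ᶠ z : ℤ, f z := by
  rw [finsum_eq_sum_of_support_subset (s := (Finset.range B).map Nat.castEmbedding)]
  · simp
  · intro z hz
    obtain ⟨h1, h2⟩ := hf z hz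
    lift z to ℕ using h1
    simpa using h2

lemma sum_range_reindex (e : ℤ ≃ ℤ) (f g : ℤ → ℚ) (B M : ℕ) (h : ∀ z, f (e z) = g z)
    (hf : ∀ z, f z ≠ 0 → 0 ≤ z ∧ z < B) (hg : ∀ z, g z ≠ 0 → 0 ≤ z ∧ z < M) :
    ∑ z ∈ Finset.range B, f z = ∑ z ∈ Finset.range M, g z := by
  rw [sum_range_eq_finsum f B hf, sum_range_eq_finsum g M hg, ← finsum_comp_equiv e]
  exact finsum_congr h

/-- The sign `(-1) ^ n` for an integer `n`. -/
def sg (n : ℤ) : ℚ := (-1) ^ n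

lemma sg_natCast (n : ℕ) : sg n = (-1) ^ n := zpow_natCast _ _

lemma sg_add (m n : ℤ) : sg (m + n) = sg m * sg n := zpow_add₀ (by norm_num) _ _

lemma sg_mul_self (n : ℤ) : sg n * sg n = 1 := by
  rw [sg, ← mul_zpow]
  simp

lemma sg_sub (m n : ℤ) : sg (m - n) = sg m * sg n := by
  have h := sg_add (m - n) n
  rw [sub_add_cancel] at h
  rw [h, mul_assoc, sg_mul_self, mul_one]

lemma sg_one : sg 1 = -1 := by simp [sg]

/-- `sum_reflection` with the left side indexed by `v - i` and the right side by
`i - v - q - 1`. -/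
lemma sum_reflection_left (p q r u v y : ℤ) (hp : 0 ≤ p) (hq : 0 ≤ q) (hr : 0 ≤ r)
    (hu : 0 ≤ u + p) (hv : v ≤ y + r) (hy : y ≤ v + q) (B : ℕ) (hB : v < B) (hB' : p + r - v < B)
    {n H G α β H' γ δ ε ζ η : ℤ} (e1 : n = y + r - v) (e2 : H = v + u + p) (e3 : G = v + u)
    (e4 : α = y - v) (e5 : β = p + q + r + 1 - v) (e6 : H' = v + q + 1 + u + p)
    (e7 : γ = v + q - y - r) (e8 : δ = v + q + 1) (e9 : ε = v + q + 1 + u) (e10 : ζ = v + q - y)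
    (e11 : η = p + r - v) :
    ∑ z ∈ Finset.range B, sg z * ((ff (q + z) * ff (n + z) * ff (H - z) *
        (rf z * rf (G - z) * rf (v - z))) * (rf (α + z) * rf (β + z))) =
      sg r * ∑ z ∈ Finset.range B, sg z * ((ff (q + z) * ff (H' + z) *
        (rf z * rf (γ + z) * rf (δ + z) * rf (ε + z))) * (ff (ζ + z) * rf (η - z))) := by
  subst e1 e2 e3 e4 e5 e6 e7 e8 e9 e10 e11
  lift p to ℕ using hp
  lift q to ℕ using hq
  lift r to ℕ using hr
  have key := sum_reflection p q r u v y hu hv hy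
  simp only [← sg_natCast] at key
  have hl := sum_range_reindex (Equiv.subLeft v)
    (fun z => sg z * ((ff (q + z) * ff (y + r - v + z) * ff (v + u + p - z) *
        (rf z * rf (v + u - z) * rf (v - z))) * (rf (y - v + z) * rf (p + q + r + 1 - v + z))))
    (fun i => sg v * (sg i * (rf i * rf ((p + q + r + 1 : ℕ) - i)) *
        (ff (i + u + p) * rf (i + u) * (ff (v + q - i) * rf (v - i)) *
          (ff (y + r - i) * rf (y - i))))) B (p + q + r + 2) (fun z => by
        simp only [Equiv.subLeft_apply, sg_sub]
        push_cast
        ring_nf)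
      (fun z hz => by
        simp only [mul_ne_zero_iff] at hz
        have h1 := nonneg_of_rf hz.2.1.2.1.1
        have h2 := nonneg_of_rf hz.2.1.2.2
        omega)
      (fun z hz => by
        simp only [mul_ne_zero_iff] at hz
        have h1 := nonneg_of_rf hz.2.1.2.1
        have h2 := nonneg_of_rf hz.2.1.2.2
        omega)
  have hr := sum_range_reindex (Equiv.addRight (v + q + 1)).symm
    (fun z => sg z * ((ff (q + z) * ff (v + q + 1 + u + p + z) *
        (rf z * rf (v + q - y - r + z) * rf (v + q + 1 + z) * rf (v + q + 1 + u + z))) *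
          (ff (v + q - y + z) * rf (p + r - v - z))))
    (fun i => sg (v + q + 1) * (sg i * (rf i * rf ((p + q + r + 1 : ℕ) - i)) *
        (ff (i + u + p) * rf (i + u) * (ff (i - v - 1) * rf (i - v - q - 1)) *
          (ff (i - y - 1) * rf (i - y - r - 1))))) B (p + q + r + 2) (fun z => by
        simp only [Equiv.addRight_symm_apply, sg_sub, ← sub_eq_add_neg]
        push_cast
        ring_nf)
      (fun z hz => by
        simp only [mul_ne_zero_iff] at hz
        have h1 := nonneg_of_rf hz.2.1.2.1.1.1
        have h2 := nonneg_of_rf hz.2.2.2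
        omega)
      (fun z hz => by
        simp only [mul_ne_zero_iff] at hz
        have h1 := nonneg_of_rf hz.2.1.2.1
        have h2 := nonneg_of_rf hz.2.1.2.2
        omega)
  rw [hl, hr, ← Finset.mul_sum, ← Finset.mul_sum, key]
  have hs (T : ℚ) : sg v * -(sg (q + r : ℕ) * T) = sg r * (sg (v + q + 1) * T) := by
    simp only [sg_add, sg_one, Nat.cast_add]
    ring
  exact hs _

/-- `sum_reflection` with the left side indexed by `u + i` and the right side by
`p + q + r + 1 - i`. -/
lemma sum_reflection_right (p q r u v y : ℤ) (hp : 0 ≤ p) (hq : 0 ≤ q) (hr : 0 ≤ r)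
    (hu : 0 ≤ u + p) (hv : v ≤ y + r) (hy : y ≤ v + q) (B : ℕ) (hB : y + u < B)
    (hB' : p + r - v < B) {E F G H α β K L O Q γ δ : ℤ} (e1 : E = v + q + u) (e2 : F = y + u)
    (e3 : G = v + u) (e4 : H = p + q + r + 1 + u) (e5 : α = y + r + u) (e6 : β = -u)
    (e7 : K = p + q + r - y) (e8 : L = p + q + r - v) (e9 : O = 2 * p + q + r + 1 + u)
    (e10 : Q = p + r - v) (e11 : γ = p + q - y) (e12 : δ = p + q + r + 1) :
    ∑ z ∈ Finset.range B, sg z * ((ff (E - z) * ff (p + z) *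
        (rf z * rf (F - z) * rf (G - z) * rf (H - z))) * (ff (α - z) * rf (β + z))) =
      sg (u + p) * ∑ z ∈ Finset.range B, sg z * ((ff (K - z) * ff (L - z) * ff (O - z) *
        (rf z * rf (Q - z) * rf (H - z))) * (rf (γ - z) * rf (δ - z))) := by
  subst e1 e2 e3 e4 e5 e6 e7 e8 e9 e10 e11 e12
  lift p to ℕ using hp
  lift q to ℕ using hq
  lift r to ℕ using hr
  have key := sum_reflection p q r u v y hu hv hy
  simp only [← sg_natCast] at key
  have hl := sum_range_reindex (Equiv.addRight u)
    (fun z => sg z * ((ff (v + q + u - z) * ff (p + z) *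
        (rf z * rf (y + u - z) * rf (v + u - z) * rf (p + q + r + 1 + u - z))) *
          (ff (y + r + u - z) * rf (-u + z))))
    (fun i => sg u * (sg i * (rf i * rf ((p + q + r + 1 : ℕ) - i)) *
        (ff (i + u + p) * rf (i + u) * (ff (v + q - i) * rf (v - i)) *
          (ff (y + r - i) * rf (y - i))))) B (p + q + r + 2) (fun z => by
        simp only [Equiv.coe_addRight, sg_add]
        push_cast
        ring_nf)
      (fun z hz => by
        simp only [mul_ne_zero_iff] at hz
        have h1 := nonneg_of_rf hz.2.1.2.1.1.1
        have h2 := nonneg_of_rf hz.2.1.2.1.1.2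
        omega)
      (fun z hz => by
        simp only [mul_ne_zero_iff] at hz
        have h1 := nonneg_of_rf hz.2.1.2.1
        have h2 := nonneg_of_rf hz.2.1.2.2
        omega)
  have hr := sum_range_reindex (Equiv.subLeft ((p + q + r + 1 : ℕ) : ℤ))
    (fun z => sg z * ((ff (p + q + r - y - z) * ff (p + q + r - v - z) *
        ff (2 * p + q + r + 1 + u - z) *
        (rf z * rf (p + r - v - z) * rf (p + q + r + 1 + u - z))) *
          (rf (p + q - y - z) * rf (p + q + r + 1 - z))))
    (fun i => sg (p + q + r + 1 : ℕ) * (sg i * (rf i * rf ((p + q + r + 1 : ℕ) - i)) *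
        (ff (i + u + p) * rf (i + u) * (ff (i - v - 1) * rf (i - v - q - 1)) *
          (ff (i - y - 1) * rf (i - y - r - 1))))) B (p + q + r + 2) (fun z => by
        simp only [Equiv.subLeft_apply, sg_sub]
        push_cast
        ring_nf)
      (fun z hz => by
        simp only [mul_ne_zero_iff] at hz
        have h1 := nonneg_of_rf hz.2.1.2.1.1
        have h2 := nonneg_of_rf hz.2.1.2.1.2
        omega)
      (fun z hz => by
        simp only [mul_ne_zero_iff] at hz
        have h1 := nonneg_of_rf hz.2.1.2.1
        have h2 := nonneg_of_rf hz.2.1.2.2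
        omega)
  rw [hl, hr, ← Finset.mul_sum, ← Finset.mul_sum, key]
  simp only [sg_add, sg_one, Nat.cast_add, Nat.cast_one]
  linear_combination (sg u * sg q * sg r * ∑ i ∈ Finset.range (p + q + r + 2),
        sg i * (rf i * rf ((p + q + r + 1) - i)) *
        (ff (i + u + p) * rf (i + u) * (ff (i - v - 1) * rf (i - v - q - 1)) *
          (ff (i - y - 1) * rf (i - y - r - 1)))) * sg_mul_self p

lemma kernel_sum_natCast (q s m : ℕ) :
    ∑ j ∈ Finset.range (m + 1), ((s + q + 2 * j + 1 : ℤ) : ℚ) * (ff (s + q + j) * ff (s + j) *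
      (rf j * rf (q + j)) * (rf (m - j) * rf (m + s + q + 1 + j))) =
      ff s * (rf m * rf (m + q)) := by
  induction m with
  | zero =>
    have h1 := ff_mul_rf (n := s + q) (by omega)
    have h2 := rf_sub_one (s + q + 1)
    have h3 : rf 0 = 1 := by simp [rf, ff]
    rw [add_sub_cancel_right] at h2
    rw [h2] at h1
    simp only [zero_add, Finset.sum_range_one, Nat.cast_zero, add_zero, mul_zero, sub_zero, h3]
    push_cast at h1 ⊢
    linear_combination (ff s * rf q) * h1
  | succ m ih =>
    set F : ℕ → ℕ → ℚ := fun m j => ((s + q + 2 * j + 1 : ℤ) : ℚ) * (ff (s + q + j) * ff (s + j) *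
      (rf j * rf (q + j)) * (rf (m - j) * rf (m + s + q + 1 + j))) with hF
    set G : ℕ → ℚ := fun j => -(ff (s + q + j) * ff (s + j) * (rf (j - 1) * rf (q + j - 1)) *
      (rf (m + 1 - j) * rf (m + s + q + 1 + j))) with hG
    have step (j : ℕ) : ((m : ℚ) + 1) * (m + 1 + q) * F (m + 1) j - F m j = G (j + 1) - G j := by
      have h1 := rf_sub_one j
      have h2 := rf_sub_one (q + j)
      have h3 := rf_sub_one (m + 1 - j)
      have h4 := rf_sub_one (m + s + q + 2 + j)
      have h5 := ff_add_one (n := s + q + j) (by omega)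
      have h6 := ff_add_one (n := s + j) (by omega)
      rw [show (m : ℤ) + 1 - j - 1 = m - j by ring] at h3
      rw [show (m : ℤ) + s + q + 2 + j - 1 = m + s + q + 1 + j by ring] at h4
      simp only [hF, hG, Nat.cast_add, Nat.cast_one, add_sub_cancel_right, ← add_assoc]
      rw [show (m : ℤ) + 1 - (j + 1) = m - j by ring,
        show (m : ℤ) + s + q + 1 + j + 1 = m + s + q + 2 + j by ring,
        show (m : ℤ) + 1 + s + q + 1 + j = m + s + q + 2 + j by ring, h1, h2, h3, h4, h5, h6]
      push_cast
      ring
    have hsum : ∑ j ∈ Finset.range (m + 2), (((m : ℚ) + 1) * (m + 1 + q) * F (m + 1) j - F m j) =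
        0 := by
      rw [Finset.sum_congr rfl fun j _ => step j, Finset.sum_range_sub]
      simp only [hG]
      rw [rf_neg (n := (m : ℤ) + 1 - (m + 2 : ℕ)) (by push_cast; omega),
        rf_neg (n := ((0 : ℕ) : ℤ) - 1) (by simp)]
      ring
    rw [Finset.sum_sub_distrib, ← Finset.mul_sum, Finset.sum_range_succ (F m)] at hsum
    have h0 : F m (m + 1) = 0 := by
      simp only [hF]
      rw [rf_neg (n := (m : ℤ) - (m + 1 : ℕ)) (by push_cast; omega)]
      ring
    rw [h0, add_zero, show ∑ j ∈ Finset.range (m + 1), F m j = ff s * (rf m * rf (m + q)) from ih]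
      at hsum
    have h1 := rf_sub_one (m + 1)
    have h2 := rf_sub_one (m + 1 + q)
    rw [add_sub_cancel_right] at h1
    rw [show (m : ℤ) + 1 + q - 1 = m + q by ring] at h2
    rw [h1, h2] at hsum
    have hm : ((m : ℚ) + 1) * (m + 1 + q) ≠ 0 := by positivity
    apply mul_left_cancel₀ hm
    simp only [hF, Nat.cast_add, Nat.cast_one] at hsum ⊢
    push_cast at hsum ⊢
    linear_combination hsum

lemma kernel_sum_of_nonneg (q s m : ℤ) (hq : 0 ≤ q) (hs : 0 ≤ s) (J : ℕ) (hJ : m < J) :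
    ∑ j ∈ Finset.range J, ((s + q + 2 * j + 1 : ℤ) : ℚ) * (ff (s + q + j) * ff (s + j) *
      (rf j * rf (q + j)) * (rf (m - j) * rf (m + s + q + 1 + j))) =
      ff s * (rf m * rf (m + q)) := by
  rcases lt_or_ge m 0 with hm | hm
  · rw [rf_neg hm, zero_mul, mul_zero]
    refine Finset.sum_eq_zero fun j _ => ?_
    rw [rf_neg (n := m - j) (by omega)]
    ring
  lift q to ℕ using hq
  lift s to ℕ using hs
  lift m to ℕ using hm
  rw [← kernel_sum_natCast]
  symm
  refine Finset.sum_subset (fun j hj => ?_) fun j _ hj => ?_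
  · simp only [Finset.mem_range] at hj ⊢
    omega
  · rw [Finset.mem_range] at hj
    rw [rf_neg (n := (m : ℤ) - j) (by omega)]
    ring

/-- A terminating very-well-poised summation. -/
lemma kernel_sum (q s m : ℤ) (hs : 0 ≤ s) (J : ℕ) (hJ : m < J) :
    ∑ j ∈ Finset.range J, ((s + q + 2 * j + 1 : ℤ) : ℚ) * (ff (s + q + j) * ff (s + j) *
      (rf j * rf (q + j)) * (rf (m - j) * rf (m + s + q + 1 + j))) =
      ff s * (rf m * rf (m + q)) := by
  rcases le_or_gt 0 q with hq | hq
  · exact kernel_sum_of_nonneg q s m hq hs J hJ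
  have h := kernel_sum_of_nonneg (-q) s (m + q) (by omega) hs J (by omega)
  rw [add_neg_cancel_right, mul_comm (rf (m + q))] at h
  rw [← h]
  refine sum_range_reindex (Equiv.subRight q)
    (fun j => ((s + q + 2 * j + 1 : ℤ) : ℚ) * (ff (s + q + j) * ff (s + j) *
      (rf j * rf (q + j)) * (rf (m - j) * rf (m + s + q + 1 + j))))
    (fun j => ((s + -q + 2 * j + 1 : ℤ) : ℚ) * (ff (s + -q + j) * ff (s + j) *
      (rf j * rf (-q + j)) * (rf (m + q - j) * rf (m + q + s + -q + 1 + j)))) J J ?_ ?_ ?_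
  · intro z
    simp only [Equiv.subRight_apply]
    push_cast
    ring_nf
  all_goals
    intro z hz
    simp only [mul_ne_zero_iff] at hz
    have h1 := nonneg_of_rf hz.2.1.2.1
    have h2 := nonneg_of_rf hz.2.2.1
    omega

lemma sg_ne_zero (n : ℤ) : sg n ≠ 0 := zpow_ne_zero _ (by norm_num)

/-- The terms of the first balanced sum in the expansion of `S_A`. -/
def termA₁ (A C n₃ n₆ q : ℤ) (z : ℕ) : ℚ :=
  ff (q + z) * ff (n₃ + z) * ff (A + C - 2 * n₃ - z) *
    (rf z * rf (A + C - 2 * n₃ - n₆ - z) * rf (C - n₃ - z))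

/-- The terms of the second balanced sum in the expansion of `S_A`. -/
def termA₂ (B C D n₂ n₄ : ℤ) (z : ℕ) : ℚ :=
  ff (D - z) * ff (C - n₂ + z) *
    (rf z * rf (D - n₄ - z) * rf (n₂ - z) * rf (B + D - n₄ + 1 - z))

/-- The terms of the first balanced sum in the expansion of `S_X`. -/
def termX₁ (A C n₃ n₆ q : ℤ) (z : ℕ) : ℚ :=
  ff (q + z) * ff (q + A + C - 2 * n₃ + 1 + z) *
    (rf z * rf (q - n₃ + z) * rf (q + C - n₃ + 1 + z) * rf (q + A + C - 2 * n₃ - n₆ + 1 + z))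

/-- The terms of the second balanced sum in the expansion of `S_X`. -/
def termX₂ (B C D n₂ n₄ : ℤ) (z : ℕ) : ℚ :=
  ff (B - z) * ff (B + D - n₂ - n₄ - z) * ff (B + C + D - n₂ - n₄ + 1 - z) *
    (rf z * rf (B - n₄ - z) * rf (B + D - n₄ + 1 - z))

lemma mul_sum_eq_mul_sum (A B C D n₁ n₂ n₃ n₄ n₅ n₆ q j : ℤ)
    (hn₆ : n₆ = n₁ + n₂ - n₃ - n₄ + n₅) (hq : q = B + D - 2 * n₄ - n₆) (h₁ : 0 ≤ n₁)
    (hC : 0 ≤ C) (hC₂ : 0 ≤ C - n₂) (hD₂ : 0 ≤ D - n₂) (h₃ : 0 ≤ n₃) (hA₃ : 0 ≤ A - n₃)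
    (h₄ : 0 ≤ n₄) (h₆ : 0 ≤ n₆) (hq₀ : 0 ≤ q)
    (hS : 0 ≤ C + D - 2 * n₂ - n₅) (hj : 0 ≤ j)
    (hWj : 0 ≤ C + D - B - 2 * n₂ + 2 * n₁ + j) (N : ℕ) (hN₁ : C - n₃ < N)
    (hN₂ : 2 * n₁ + n₅ - B + j < N) (hN₃ : D - n₄ < N) (hN₄ : B - n₄ < N) :
    (∑ z ∈ Finset.range N, sg z * (termA₁ A C n₃ n₆ q z *
        (rf (B - C - n₁ + n₂ + n₃ - n₄ - j + z) * rf (D + n₁ - n₂ + n₃ - n₄ + 1 + j + z)))) *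
      (∑ z ∈ Finset.range N, sg z * (termA₂ B C D n₂ n₄ z *
        (ff (n₁ + D - n₄ + j - z) * rf (C - B + n₁ - 2 * n₂ + n₄ + j + z)))) =
    sg C * ((∑ z ∈ Finset.range N, sg z * (termX₁ A C n₃ n₆ q z *
        (ff (C + D - 2 * n₂ - n₅ + j + z) * rf (2 * n₁ + n₅ - B + j - z)))) *
      (∑ z ∈ Finset.range N, sg z * (termX₂ B C D n₂ n₄ z *
        (rf (B - n₁ - j - z) * rf (C + D - 2 * n₂ + n₁ + 1 + j - z))))) := by
  obtain ⟨y, hy⟩ : ∃ y, y = n₂ + B - n₁ - n₄ - j := ⟨_, rfl⟩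
  simp only [termA₁, termA₂, termX₁, termX₂]
  have left (hr : 0 ≤ C - y) := sum_reflection_left n₆ q (C - y) (A - n₃ - n₆) (C - n₃) y h₆ hq₀ hr
    (by omega) (by omega) (by omega) N hN₁ (by omega)
    (n := n₃) (H := A + C - 2 * n₃) (G := A + C - 2 * n₃ - n₆)
    (α := B - C - n₁ + n₂ + n₃ - n₄ - j) (β := D + n₁ - n₂ + n₃ - n₄ + 1 + j)
    (H' := q + A + C - 2 * n₃ + 1) (γ := q - n₃) (δ := q + C - n₃ + 1)
    (ε := q + A + C - 2 * n₃ - n₆ + 1) (ζ := C + D - 2 * n₂ - n₅ + j) (η := 2 * n₁ + n₅ - B + j)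
    (by omega) (by omega) (by omega) (by omega) (by omega) (by omega) (by omega) (by omega)
    (by omega) (by omega) (by omega)
  have right (hy₀ : 0 ≤ y) (hr : C - y ≤ C + D - B - 2 * n₂ + 2 * n₁ + 2 * j) :=
    sum_reflection_right (C - n₂) (D - n₂) (n₁ + j) (y - (C - n₂)) (C - y)
    (C + D - 2 * n₂ - B + n₁ + j) hC₂ hD₂ (by omega) (by omega) (by omega) (by omega) N
    (by omega) (by omega)
    (E := D) (F := D - n₄) (G := n₂) (H := B + D - n₄ + 1) (α := n₁ + D - n₄ + j)
    (β := C - B + n₁ - 2 * n₂ + n₄ + j) (K := B) (L := B + D - n₂ - n₄)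
    (O := B + C + D - n₂ - n₄ + 1) (Q := B - n₄) (γ := B - n₁ - j)
    (δ := C + D - 2 * n₂ + n₁ + 1 + j)
    (by omega) (by omega) (by omega) (by omega) (by omega) (by omega) (by omega) (by omega)
    (by omega) (by omega) (by omega) (by omega)
  rcases lt_or_ge y 0 with hy₀ | hy₀
  · have hl := left (by omega)
    have h0 : ∑ z ∈ Finset.range N, sg z * ((ff (q + z) * ff (n₃ + z) * ff (A + C - 2 * n₃ - z) *
        (rf z * rf (A + C - 2 * n₃ - n₆ - z) * rf (C - n₃ - z))) *
        (rf (B - C - n₁ + n₂ + n₃ - n₄ - j + z) * rf (D + n₁ - n₂ + n₃ - n₄ + 1 + j + z))) = 0 := by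
      refine Finset.sum_eq_zero fun z _ => ?_
      by_contra hz
      simp only [mul_ne_zero_iff, ← ne_eq] at hz
      have h1 := nonneg_of_rf hz.2.1.2.2
      have h2 := nonneg_of_rf hz.2.2.1
      omega
    rw [h0, zero_eq_mul, or_iff_right (sg_ne_zero _)] at hl
    rw [h0, hl, zero_mul, zero_mul, mul_zero]
  rcases lt_or_ge (C - y) 0 with hr₀ | hr₀
  · have hl := right hy₀ (by omega)
    have h0 : ∑ z ∈ Finset.range N, sg z * ((ff (D - z) * ff (C - n₂ + z) *
        (rf z * rf (D - n₄ - z) * rf (n₂ - z) * rf (B + D - n₄ + 1 - z))) *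
        (ff (n₁ + D - n₄ + j - z) * rf (C - B + n₁ - 2 * n₂ + n₄ + j + z))) = 0 := by
      refine Finset.sum_eq_zero fun z _ => ?_
      by_contra hz
      simp only [mul_ne_zero_iff, ← ne_eq] at hz
      have h1 := nonneg_of_rf hz.2.1.2.1.2
      have h2 := nonneg_of_rf hz.2.2.2
      omega
    rw [h0, zero_eq_mul, or_iff_right (sg_ne_zero _)] at hl
    rw [h0, hl, mul_zero, mul_zero, mul_zero]
  rcases lt_or_ge (C + D - B - 2 * n₂ + 2 * n₁ + 2 * j) (C - y) with hx | hx
  · have hl := left hr₀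
    have h0 : ∑ z ∈ Finset.range N, sg z * ((ff (q + z) * ff (q + A + C - 2 * n₃ + 1 + z) *
        (rf z * rf (q - n₃ + z) * rf (q + C - n₃ + 1 + z) *
          rf (q + A + C - 2 * n₃ - n₆ + 1 + z))) *
        (ff (C + D - 2 * n₂ - n₅ + j + z) * rf (2 * n₁ + n₅ - B + j - z))) = 0 := by
      refine Finset.sum_eq_zero fun z _ => ?_
      by_contra hz
      simp only [mul_ne_zero_iff, ← ne_eq] at hz
      have h1 := nonneg_of_rf hz.2.1.2.1.1.2
      have h2 := nonneg_of_rf hz.2.2.2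
      omega
    rw [h0, mul_zero] at hl
    rw [h0, hl, zero_mul, zero_mul, mul_zero]
  · rw [left hr₀, right hy₀ hx, sub_add_cancel, ← sub_add_cancel C y, sg_add, sub_add_cancel]
    ring

/-- Double sums sharing a factor that expands by `kernel_sum`. -/
lemma double_sum_expand (F G : ℕ → ℚ) (s m : ℕ → ℤ) (W : ℤ) (N J : ℕ)
    (hs : ∀ b, G b ≠ 0 → 0 ≤ s b) (hm : ∀ a, F a ≠ 0 → m a < J) :
    ∑ a ∈ Finset.range N, ∑ b ∈ Finset.range N,
      F a * G b * (ff (s b) * (rf (m a) * rf (m a + (W - s b)))) =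
    ∑ j ∈ Finset.range J, ((W + 2 * j + 1 : ℤ) : ℚ) * (ff (W + j) * rf j) *
      ((∑ a ∈ Finset.range N, F a * (rf (m a - j) * rf (m a + W + 1 + j))) *
        ∑ b ∈ Finset.range N, G b * (ff (s b + j) * rf (W - s b + j))) := by
  have key (a b : ℕ) : F a * G b * (ff (s b) * (rf (m a) * rf (m a + (W - s b)))) =
      ∑ j ∈ Finset.range J, ((W + 2 * j + 1 : ℤ) : ℚ) * (ff (W + j) * rf j) *
        ((F a * (rf (m a - j) * rf (m a + W + 1 + j))) *
          (G b * (ff (s b + j) * rf (W - s b + j)))) := by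
    by_cases hF : F a = 0
    · simp [hF]
    by_cases hG : G b = 0
    · simp [hG]
    rw [← kernel_sum (W - s b) (s b) (m a) (hs b hG) J (hm a hF), Finset.mul_sum]
    refine Finset.sum_congr rfl fun j _ => ?_
    rw [add_sub_cancel, show m a + s b + (W - s b) + 1 + j = m a + W + 1 + j by ring]
    ring
  simp only [key]
  rw [Finset.sum_congr rfl fun a _ => Finset.sum_comm, Finset.sum_comm]
  refine Finset.sum_congr rfl fun j _ => ?_
  rw [Finset.sum_mul_sum]
  simp only [Finset.mul_sum]

lemma double_sum_eq (A B C D n₁ n₂ n₃ n₄ n₅ n₆ q : ℤ)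
    (hn₆ : n₆ = n₁ + n₂ - n₃ - n₄ + n₅) (hq : q = B + D - 2 * n₄ - n₆) (h₁ : 0 ≤ n₁)
    (hC : 0 ≤ C) (hC₂ : 0 ≤ C - n₂) (hD₂ : 0 ≤ D - n₂) (h₃ : 0 ≤ n₃) (hA₃ : 0 ≤ A - n₃)
    (h₄ : 0 ≤ n₄) (h₆ : 0 ≤ n₆) (hq₀ : 0 ≤ q)
    (hS : 0 ≤ C + D - 2 * n₂ - n₅) (J N : ℕ) (hJ₁ : B - n₁ + n₂ - n₄ < J) (hJ₂ : B - n₁ < J)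
    (hN₁ : C - n₃ < N) (hN₂ : 2 * n₁ + n₅ - B + J < N) (hN₃ : D - n₄ < N) (hN₄ : B - n₄ < N) :
    ∑ x ∈ Finset.range N, ∑ y ∈ Finset.range N,
      (sg x * termA₁ A C n₃ n₆ q x) * (sg y * termA₂ B C D n₂ n₄ y) * (ff (n₁ + D - n₄ - y) *
        (rf (B - C - n₁ + n₂ + n₃ - n₄ + x) * rf (n₃ - n₂ + x + y))) =
    sg C * ∑ x ∈ Finset.range N, ∑ y ∈ Finset.range N,
      (sg x * termX₁ A C n₃ n₆ q x) * (sg y * termX₂ B C D n₂ n₄ y) *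
        (ff (C + D - 2 * n₂ - n₅ + x) * (rf (B - n₁ - y) * rf (n₁ + n₅ - x - y))) := by
  have hA := double_sum_expand (fun x => sg x * termA₁ A C n₃ n₆ q x)
    (fun y => sg y * termA₂ B C D n₂ n₄ y) (fun y => n₁ + D - n₄ - y)
    (fun x => B - C - n₁ + n₂ + n₃ - n₄ + x) (C + D - B - 2 * n₂ + 2 * n₁) N J
    (fun y hy => by
      simp only [termA₂, mul_ne_zero_iff] at hy
      have h1 := nonneg_of_rf hy.2.2.1.1.2
      omega)
    (fun x hx => by
      simp only [termA₁, mul_ne_zero_iff] at hx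
      have h1 := nonneg_of_rf hx.2.2.2
      omega)
  have hX := double_sum_expand (fun y => sg y * termX₂ B C D n₂ n₄ y)
    (fun x => sg x * termX₁ A C n₃ n₆ q x) (fun x => C + D - 2 * n₂ - n₅ + x)
    (fun y => B - n₁ - y) (C + D - B - 2 * n₂ + 2 * n₁) N J
    (fun x _ => by omega) (fun y _ => by omega)
  have hL (x y : ℕ) : B - C - n₁ + n₂ + n₃ - n₄ + x +
      (C + D - B - 2 * n₂ + 2 * n₁ - (n₁ + D - n₄ - y)) = n₃ - n₂ + x + y := by ring
  have hR (x y : ℕ) : B - n₁ - y + (C + D - B - 2 * n₂ + 2 * n₁ - (C + D - 2 * n₂ - n₅ + x)) =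
      n₁ + n₅ - x - y := by ring
  simp only [hL] at hA
  simp only [hR] at hX
  rw [hA, Finset.sum_comm]
  simp only [mul_comm (sg _ * termX₁ _ _ _ _ _ _) (sg _ * termX₂ _ _ _ _ _ _)]
  rw [hX, Finset.mul_sum]
  refine Finset.sum_congr rfl fun j hj => ?_
  by_cases hWj : 0 ≤ C + D - B - 2 * n₂ + 2 * n₁ + j
  swap
  · rw [ff_neg (not_le.mp hWj)]
    ring
  rw [Finset.mem_range] at hj
  have h := mul_sum_eq_mul_sum A B C D n₁ n₂ n₃ n₄ n₅ n₆ q j hn₆ hq h₁ hC hC₂ hD₂ h₃ hA₃ h₄ h₆ hq₀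
    hS (by omega) hWj N hN₁ (by omega) hN₃ hN₄
  rw [mul_left_comm (sg C)]
  congr 1
  rw [mul_comm (∑ y ∈ Finset.range N, sg y * termX₂ B C D n₂ n₄ y * _)]
  convert h using 3
  all_goals
    try refine Finset.sum_congr rfl fun x _ => ?_
    rw [mul_assoc]
    ring_nf

lemma fct_eq_ff {x : ℚ} {n : ℤ} (h : x = n) : fct x = ff n := by rw [h, fct_intCast]

lemma neg1pw_eq_sg {x : ℚ} {n : ℤ} (h : x = n) : neg1pw x = sg n := by simp [h, neg1pw, sg]

/-- A finitely supported triple sum with a factor depending on the last index only. -/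
lemma finsum_mul_eq_sum (t : ℕ → ℕ → ℕ → ℚ) (c : ℕ → ℚ) (g : ℕ → ℕ → ℕ → ℚ) (N : ℕ)
    (ht : ∀ x y z, t x y z = c z * g z x y)
    (hN : ∀ x y z, c z * g z x y ≠ 0 → x < N ∧ y < N ∧ z < N) :
    ∑ᶠ x, ∑ᶠ y, ∑ᶠ z, t x y z =
      ∑ z ∈ Finset.range N, c z * ∑ x ∈ Finset.range N, ∑ y ∈ Finset.range N, g z x y := by
  simp only [← ht] at hN
  have h₁ (x y : ℕ) : ∑ᶠ z, t x y z = ∑ z ∈ Finset.range N, t x y z :=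
    finsum_eq_sum_of_support_subset _ fun z hz => by
      simpa using (hN x y z hz).2.2
  have h₂ (x : ℕ) : ∑ᶠ y, ∑ᶠ z, t x y z =
      ∑ y ∈ Finset.range N, ∑ z ∈ Finset.range N, t x y z := by
    simp only [h₁]
    refine finsum_eq_sum_of_support_subset _ fun y hy => ?_
    obtain ⟨z, -, hz⟩ := Finset.exists_ne_zero_of_sum_ne_zero hy
    simpa using (hN x y z hz).2.1
  have h₃ : ∑ᶠ x, ∑ᶠ y, ∑ᶠ z, t x y z =
      ∑ x ∈ Finset.range N, ∑ y ∈ Finset.range N, ∑ z ∈ Finset.range N, t x y z := by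
    simp only [h₂]
    refine finsum_eq_sum_of_support_subset _ fun x hx => ?_
    obtain ⟨y, -, hy⟩ := Finset.exists_ne_zero_of_sum_ne_zero hx
    obtain ⟨z, -, hz⟩ := Finset.exists_ne_zero_of_sum_ne_zero hy
    simpa using (hN x y z hz).1
  rw [h₃, Finset.sum_congr rfl fun x _ => Finset.sum_comm, Finset.sum_comm]
  simp only [ht, Finset.mul_sum]

/-- The factor common to `S_A` and `S_X`, depending on the last summation index only. -/
def termC (A B n₁ n₅ S : ℤ) (z : ℕ) : ℚ :=
  sg z * (ff (B - n₁ + z) * ff (A + B - 2 * n₁ - n₅ + z) *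
    (rf z * rf (n₁ - z) * rf (S - z) * rf (A + B - 2 * n₁ + 1 + z)))

/-- Equality of the Ališauskas–Jucys triple-sum formula for the SU(2) 9j
coefficient `{a b e; c d f; h k g}` and the new triple-sum formula (with only
partial triangle restrictions of the summation intervals) obtained from
expansion (vrx6a) of the paper. -/
theorem nineJ_tripleSum_A_eq_X (a b c d e f g h k : ℚ)
    (ha : IsNNHalfInt a) (hb : IsNNHalfInt b) (hc : IsNNHalfInt c)
    (hd : IsNNHalfInt d) (he : IsNNHalfInt e) (hf : IsNNHalfInt f)
    (hg : IsNNHalfInt g) (hh : IsNNHalfInt h) (hk : IsNNHalfInt k)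
    (t1 : Triad a b e) (t2 : Triad c d f) (t3 : Triad h k g)
    (t4 : Triad a c h) (t5 : Triad b d k) (t6 : Triad e f g) :
    neg1pw (c + h - a) * sumSA a b c d e f g h k =
      neg1pw (a + c - h) * sumSX a b c d e f g h k := by
  obtain ⟨-, A, hA⟩ := ha
  obtain ⟨-, B, hB⟩ := hb
  obtain ⟨-, C, hC⟩ := hc
  obtain ⟨-, D, hD⟩ := hd
  obtain ⟨⟨n₁, h₁⟩, -, ⟨m₁, k₁⟩⟩ := t1
  obtain ⟨⟨n₂, h₂⟩, ⟨l₂, i₂⟩, ⟨m₂, k₂⟩⟩ := t2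
  obtain ⟨⟨n₆, h₆⟩, -, ⟨q, hq⟩⟩ := t3
  obtain ⟨⟨n₃, h₃⟩, ⟨l₃, i₃⟩, ⟨m₃, k₃⟩⟩ := t4
  obtain ⟨⟨n₄, h₄⟩, ⟨l₄, i₄⟩, ⟨m₄, k₄⟩⟩ := t5
  obtain ⟨⟨n₅, h₅⟩, -, ⟨m₅, k₅⟩⟩ := t6
  have E₁ : B - n₁ = m₁ := by
    have : ((B - n₁ : ℤ) : ℚ) = (m₁ : ℤ) := by push_cast; linarith
    exact_mod_cast this
  have E₂ : C - n₂ = l₂ := by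
    have : ((C - n₂ : ℤ) : ℚ) = (l₂ : ℤ) := by push_cast; linarith
    exact_mod_cast this
  have E₂' : D - n₂ = m₂ := by
    have : ((D - n₂ : ℤ) : ℚ) = (m₂ : ℤ) := by push_cast; linarith
    exact_mod_cast this
  have E₃ : A - n₃ = l₃ := by
    have : ((A - n₃ : ℤ) : ℚ) = (l₃ : ℤ) := by push_cast; linarith
    exact_mod_cast this
  have E₃' : C - n₃ = m₃ := by
    have : ((C - n₃ : ℤ) : ℚ) = (m₃ : ℤ) := by push_cast; linarith
    exact_mod_cast this
  have E₄ : B - n₄ = l₄ := by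
    have : ((B - n₄ : ℤ) : ℚ) = (l₄ : ℤ) := by push_cast; linarith
    exact_mod_cast this
  have E₄' : D - n₄ = m₄ := by
    have : ((D - n₄ : ℤ) : ℚ) = (m₄ : ℤ) := by push_cast; linarith
    exact_mod_cast this
  have E₅ : C + D - 2 * n₂ - n₅ = m₅ := by
    have : ((C + D - 2 * n₂ - n₅ : ℤ) : ℚ) = (m₅ : ℤ) := by push_cast; linarith
    exact_mod_cast this
  have E₆ : (n₆ : ℤ) = n₁ + n₂ - n₃ - n₄ + n₅ := by
    have : ((n₆ : ℤ) : ℚ) = (n₁ + n₂ - n₃ - n₄ + n₅ : ℤ) := by push_cast; linarith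
    exact_mod_cast this
  have E₇ : (q : ℤ) = B + D - 2 * n₄ - n₆ := by
    have : ((q : ℤ) : ℚ) = (B + D - 2 * n₄ - n₆ : ℤ) := by push_cast; linarith
    exact_mod_cast this
  have hSA := finsum_mul_eq_sum (fun z1 z2 z3 => (-1 : ℚ) ^ (z1 + z2 + z3) *
      (fct (g - h + k + z1) * fct (a + c - h + z1) * fct (2 * h - z1) /
        ((Nat.factorial z1 : ℚ) * fct (g + h - k - z1) * fct (c - a + h - z1))) *
      (fct (2 * d - z2) * fct (c - d + f + z2) /
        ((Nat.factorial z2 : ℚ) * fct (d - b + k - z2) * fct (c + d - f - z2) *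
          fct (b + d + k + 1 - z2))) *
      (fct (b + e - a + z3) * fct (e - f + g + z3) /
        ((Nat.factorial z3 : ℚ) * fct (a + b - e - z3) * fct (f + g - e - z3) *
          fct (2 * e + 1 + z3))) *
      (fct (a + d - e + k - z2 - z3) /
        (fct (a - d + f - h + z1 + z2) * fct (e - f - h + k + z1 + z3))))
    (termC A B n₁ n₅ m₅) (fun z x y => (sg x * termA₁ A C n₃ n₆ q x) *
      (sg y * termA₂ B C D n₂ n₄ y) * (ff (n₁ - z + D - n₄ - y) *
        (rf (B - C - (n₁ - z) + n₂ + n₃ - n₄ + x) * rf (n₃ - n₂ + x + y))))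
  have hSX := finsum_mul_eq_sum (fun z1 z2 z3 => (-1 : ℚ) ^ (z1 + z2 + z3) *
      (fct (g - h + k + z1) * fct (g + h + k + 1 + z1) /
        ((Nat.factorial z1 : ℚ) * fct (g + k - a - c + z1) *
          fct (c + g + k - a + 1 + z1) * fct (2 * g + 1 + z1))) *
      (fct (2 * b - z2) * fct (b + f + k - c - z2) * fct (b + c + f + k + 1 - z2) /
        ((Nat.factorial z2 : ℚ) * fct (b + k - d - z2) * fct (b + d + k + 1 - z2))) *
      (fct (b + e - a + z3) * fct (e - f + g + z3) /
        ((Nat.factorial z3 : ℚ) * fct (a + b - e - z3) * fct (f + g - e - z3) *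
          fct (2 * e + 1 + z3))) *
      (fct (f + g - e + z1 - z3) /
        (fct (a + b + f - g - z1 - z2) * fct (b + e - a - z2 + z3))))
    (termC A B n₁ n₅ m₅) (fun z x y => (sg x * termX₁ A C n₃ n₆ q x) *
      (sg y * termX₂ B C D n₂ n₄ y) * (ff (C + D - 2 * n₂ - (n₅ + z) + x) *
        (rf (B - (n₁ - z) - y) * rf (n₁ - z + (n₅ + z) - x - y))))
  obtain ⟨J, hJ⟩ : ∃ J : ℕ, J = m₁ + n₁ + n₂ + 1 := ⟨_, rfl⟩
  obtain ⟨N, hN⟩ : ∃ N : ℕ, N = 2 * n₁ + n₅ + J + m₃ + l₄ + m₄ + n₂ + 1 := ⟨_, rfl⟩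
  rw [sumSA, sumSX, hSA N ?_ ?_, hSX N ?_ ?_, neg1pw_eq_sg (n := C - n₃) (by push_cast; linarith),
    neg1pw_eq_sg (n := n₃) (by push_cast; linarith), Finset.mul_sum, Finset.mul_sum]
  · refine Finset.sum_congr rfl fun z _ => ?_
    by_cases hz : termC A B n₁ n₅ m₅ z = 0
    · rw [hz]
      ring
    simp only [termC, mul_eq_zero, not_or] at hz
    have hz₁ := nonneg_of_rf hz.2.2.1.1.2
    have hz₂ := nonneg_of_rf hz.2.2.1.2
    rw [double_sum_eq A B C D (n₁ - z) n₂ n₃ n₄ (n₅ + z) n₆ q (by omega) (by omega) (by omega)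
      (by omega) (by omega) (by omega) (by omega) (by omega) (by omega) (by omega) (by omega)
      (by omega) J N (by omega) (by omega) (by omega) (by omega) (by omega) (by omega), sg_sub]
    linear_combination (sg n₃ * termC A B n₁ n₅ m₅ z * ∑ x ∈ Finset.range N,
      ∑ y ∈ Finset.range N, (sg x * termX₁ A C n₃ n₆ q x) *
      (sg y * termX₂ B C D n₂ n₄ y) * (ff (C + D - 2 * n₂ - (n₅ + z) + x) *
        (rf (B - (n₁ - z) - y) * rf (n₁ - z + (n₅ + z) - x - y)))) * sg_mul_self C
  · intro x y z
    rw [fct_eq_ff (x := g - h + k + x) (n := q + x) (by push_cast; linarith)]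
    rw [fct_eq_ff (x := g + h + k + 1 + x) (n := q + A + C - 2 * n₃ + 1 + x) (by push_cast; linarith)]
    rw [fct_eq_ff (x := g + k - a - c + x) (n := q - n₃ + x) (by push_cast; linarith)]
    rw [fct_eq_ff (x := c + g + k - a + 1 + x) (n := q + C - n₃ + 1 + x) (by push_cast; linarith)]
    rw [fct_eq_ff (x := 2 * g + 1 + x) (n := q + A + C - 2 * n₃ - n₆ + 1 + x) (by push_cast; linarith)]
    rw [fct_eq_ff (x := 2 * b - y) (n := B - y) (by push_cast; linarith)]
    rw [fct_eq_ff (x := b + f + k - c - y) (n := B + D - n₂ - n₄ - y) (by push_cast; linarith)]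
    rw [fct_eq_ff (x := b + c + f + k + 1 - y) (n := B + C + D - n₂ - n₄ + 1 - y) (by push_cast; linarith)]
    rw [fct_eq_ff (x := b + k - d - y) (n := B - n₄ - y) (by push_cast; linarith)]
    rw [fct_eq_ff (x := b + d + k + 1 - y) (n := B + D - n₄ + 1 - y) (by push_cast; linarith)]
    rw [fct_eq_ff (x := f + g - e + x - z) (n := C + D - 2 * n₂ - (n₅ + z) + x) (by push_cast; linarith)]
    rw [fct_eq_ff (x := a + b + f - g - x - y) (n := n₁ - z + (n₅ + z) - x - y) (by push_cast; linarith)]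
    rw [fct_eq_ff (x := b + e - a - y + z) (n := B - (n₁ - z) - y) (by push_cast; linarith)]
    rw [fct_eq_ff (x := b + e - a + z) (n := B - n₁ + z) (by push_cast; linarith)]
    rw [fct_eq_ff (x := e - f + g + z) (n := A + B - 2 * n₁ - n₅ + z) (by push_cast; linarith)]
    rw [fct_eq_ff (x := a + b - e - z) (n := n₁ - z) (by push_cast; linarith)]
    rw [fct_eq_ff (x := f + g - e - z) (n := m₅ - z) (by push_cast; linarith)]
    rw [fct_eq_ff (x := 2 * e + 1 + z) (n := A + B - 2 * n₁ + 1 + z) (by push_cast; linarith)]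
    simp only [termC, termX₁, termX₂, sg_natCast, rf, ff_natCast, div_eq_mul_inv, mul_inv, pow_add]
    ring
  · intro x y z hz
    simp only [termC, termX₂, mul_ne_zero_iff] at hz
    have hx := nonneg_of_rf hz.2.2.2.2
    have hy := nonneg_of_rf hz.2.1.2.2.2.1.2
    have hz := nonneg_of_rf hz.1.2.2.1.1.2
    omega
  · intro x y z
    rw [fct_eq_ff (x := g - h + k + x) (n := q + x) (by push_cast; linarith)]
    rw [fct_eq_ff (x := a + c - h + x) (n := n₃ + x) (by push_cast; linarith)]
    rw [fct_eq_ff (x := 2 * h - x) (n := A + C - 2 * n₃ - x) (by push_cast; linarith)]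
    rw [fct_eq_ff (x := g + h - k - x) (n := A + C - 2 * n₃ - n₆ - x) (by push_cast; linarith)]
    rw [fct_eq_ff (x := c - a + h - x) (n := C - n₃ - x) (by push_cast; linarith)]
    rw [fct_eq_ff (x := 2 * d - y) (n := D - y) (by push_cast; linarith)]
    rw [fct_eq_ff (x := c - d + f + y) (n := C - n₂ + y) (by push_cast; linarith)]
    rw [fct_eq_ff (x := d - b + k - y) (n := D - n₄ - y) (by push_cast; linarith)]
    rw [fct_eq_ff (x := c + d - f - y) (n := n₂ - y) (by push_cast; linarith)]
    rw [fct_eq_ff (x := b + d + k + 1 - y) (n := B + D - n₄ + 1 - y) (by push_cast; linarith)]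
    rw [fct_eq_ff (x := a + d - e + k - y - z) (n := n₁ - z + D - n₄ - y) (by push_cast; linarith)]
    rw [fct_eq_ff (x := a - d + f - h + x + y) (n := n₃ - n₂ + x + y) (by push_cast; linarith)]
    rw [fct_eq_ff (x := e - f - h + k + x + z) (n := B - C - (n₁ - z) + n₂ + n₃ - n₄ + x) (by push_cast; linarith)]
    rw [fct_eq_ff (x := b + e - a + z) (n := B - n₁ + z) (by push_cast; linarith)]
    rw [fct_eq_ff (x := e - f + g + z) (n := A + B - 2 * n₁ - n₅ + z) (by push_cast; linarith)]
    rw [fct_eq_ff (x := a + b - e - z) (n := n₁ - z) (by push_cast; linarith)]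
    rw [fct_eq_ff (x := f + g - e - z) (n := m₅ - z) (by push_cast; linarith)]
    rw [fct_eq_ff (x := 2 * e + 1 + z) (n := A + B - 2 * n₁ + 1 + z) (by push_cast; linarith)]
    simp only [termC, termA₁, termA₂, sg_natCast, rf, ff_natCast, div_eq_mul_inv, mul_inv, pow_add]
    ring
  · intro x y z hz
    simp only [termC, termA₁, termA₂, mul_ne_zero_iff] at hz
    have hx := nonneg_of_rf hz.2.1.1.2.2.2
    have hy := nonneg_of_rf hz.2.1.2.2.2.1.2
    have hz := nonneg_of_rf hz.1.2.2.1.1.2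
    omega
end
end

section
/- Define the double sums S1 = Σ_{s,z} (−1)^(s+z) · (a−c+h+s)! (k−b+d+z)! (h+k−e−f+s+z)! / [s!(a+c−h−s)!(b−c−e+h+s)!(2h+1+s)! · z!(b+d−k−z)!(k−b+c−f+z)!(2k+1+z)!] and S2 = Σ_{s,z} (−1)^(a+b+c+d−h−k+s+z) · (2a−s)! (c+h−a+s)! (2d−z)! (b−d+k+z)! / [s!(a+c−h−s)! · z!(b+d−k−z)! · (d−a−f+h+s−z)!(a−d−e+k−s+z)!]. Then, under the triangle conditions of the stretched 9j symbol {a b e; c d f; h k e+f}, one has (b+k−d)! · (b+d+k+1)! · (c+h−a)! · (a+c+h+1)! · S1 = (h+k−e−f)! · S2 (the exponent a+b+c+d−h−k is an integer). This identity relates the paper's double-sum expression (stra) for the stretched SU(2) 9j coefficient with g = e+f to the symmetric double-sum expression (stdK), the q = 1 case of the q-generalization of the standard formula for stretched 9j coefficients; it is a rearrangement formula for special Kampé de Fériet functions. -/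
noncomputable section

/-- The double sum `S1` of the expression (stra) for the stretched 9j
coefficient `{a b e; c d f; h k e+f}`. -/
def sumS1 (a b c d e f h k : ℚ) : ℚ :=
  ∑ᶠ s : ℕ, ∑ᶠ z : ℕ,
    (-1 : ℚ) ^ (s + z) *
      fct (a - c + h + s) * fct (k - b + d + z) * fct (h + k - e - f + s + z) /
      ((Nat.factorial s : ℚ) * fct (a + c - h - s) * fct (b - c - e + h + s) *
        fct (2 * h + 1 + s) * (Nat.factorial z : ℚ) * fct (b + d - k - z) *
        fct (k - b + c - f + z) * fct (2 * k + 1 + z))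

/-- The double sum `S2` of the symmetric expression (stdK) for the stretched 9j
coefficient `{a b e; c d f; h k e+f}`. -/
def sumS2 (a b c d e f h k : ℚ) : ℚ :=
  ∑ᶠ s : ℕ, ∑ᶠ z : ℕ,
    neg1pw (a + b + c + d - h - k + s + z) *
      fct (2 * a - s) * fct (c + h - a + s) * fct (2 * d - z) * fct (b - d + k + z) /
      ((Nat.factorial s : ℚ) * fct (a + c - h - s) * (Nat.factorial z : ℚ) *
        fct (b + d - k - z) * fct (d - a - f + h + s - z) *
        fct (a - d - e + k - s + z))

open Nat in
/-- The value `∫₀¹ x ^ m (1 - x) ^ n dx` of the beta integral. -/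
def betaNat (m n : ℕ) : ℚ := (m ! * n ! : ℚ) / (m + n + 1)!

/-- The binomial coefficient `n` over `m`, extended by zero to all integers `m`. -/
def intChoose (n : ℕ) (m : ℤ) : ℚ :=
  (Nat.factorial n : ℚ) * (fct (m : ℚ))⁻¹ * (fct ((n - m : ℤ) : ℚ))⁻¹

theorem fct_natCast (n : ℕ) : fct (n : ℚ) = Nat.factorial n := by
  simp [fct]

theorem fct_intCast_of_neg {m : ℤ} (hm : m < 0) : fct (m : ℚ) = 0 := by
  have : ¬ (0 : ℚ) ≤ m := by exact_mod_cast not_le.mpr hm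
  simp [fct, this]

theorem inv_fct_sub_one (m : ℤ) : (fct ((m - 1 : ℤ) : ℚ))⁻¹ = m * (fct (m : ℚ))⁻¹ := by
  rcases lt_trichotomy m 0 with hm | rfl | hm
  · rw [fct_intCast_of_neg hm, fct_intCast_of_neg (by lia)]
    simp
  · rw [fct_intCast_of_neg (by lia)]
    simp
  · obtain ⟨n, rfl⟩ : ∃ n : ℕ, m = n + 1 := ⟨(m - 1).toNat, by lia⟩
    have h1 : (((n + 1 : ℤ) - 1 : ℤ) : ℚ) = (n : ℕ) := by push_cast; ring
    have h2 : ((n + 1 : ℤ) : ℚ) = ((n + 1 : ℕ) : ℚ) := by push_cast; ring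
    rw [h1, h2, fct_natCast, fct_natCast, Nat.factorial_succ]
    have : (n + 1 : ℚ) ≠ 0 := by positivity
    push_cast
    field_simp

theorem intChoose_succ_succ (n : ℕ) (m : ℤ) :
    intChoose (n + 1) (m + 1) = intChoose n m + intChoose n (m + 1) := by
  have h1 := inv_fct_sub_one (m + 1)
  have h2 := inv_fct_sub_one (n - m)
  rw [show m + 1 - 1 = m by ring] at h1
  rw [show (n : ℤ) - m - 1 = n - (m + 1) by ring] at h2
  unfold intChoose
  rw [h1, h2, show ((n + 1 : ℕ) : ℤ) - (m + 1) = n - m by push_cast; ring, Nat.factorial_succ]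
  push_cast
  ring

theorem intChoose_symm (n : ℕ) (m : ℤ) : intChoose n (n - m) = intChoose n m := by
  unfold intChoose
  rw [sub_sub_cancel]
  ring

theorem betaNat_succ_add_succ (m n : ℕ) :
    betaNat (m + 1) n + betaNat m (n + 1) = betaNat m n := by
  unfold betaNat
  rw [show m + 1 + n + 1 = m + n + 1 + 1 by ring, show m + (n + 1) + 1 = m + n + 1 + 1 by ring,
    Nat.factorial_succ (m + n + 1), Nat.factorial_succ m, Nat.factorial_succ n]
  have h1 : (m + n + 1 + 1 : ℚ) ≠ 0 := by positivity
  push_cast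
  field_simp
  ring

open Finset in
/-- The two expansions of `∫₀¹ x ^ A (1 - x) ^ C ((1 - x) - x u) ^ P dx`, where `u` and `1 + u`
act on a function `g` satisfying the Pascal recurrence as shifts of its arguments. -/
theorem sum_choose_mul_betaNat_mul (g : ℕ → ℤ → ℚ)
    (hg : ∀ n m, g (n + 1) (m + 1) = g n m + g n (m + 1)) (P A C G : ℕ) (Q : ℤ) :
    ∑ s ∈ range (P + 1), (P.choose s : ℚ) *
        ((-1) ^ s * betaNat (A + s) C * g (G + s) (Q + s)) =
      ∑ s ∈ range (P + 1), (P.choose s : ℚ) *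
        ((-1) ^ (P - s) * betaNat (A + (P - s)) (C + s) * g G (Q + (P - s : ℕ))) := by
  induction P generalizing A C G Q with
  | zero => simp
  | succ P ih =>
    rw [sum_choose_succ_mul (fun s _ => (-1) ^ s * betaNat (A + s) C * g (G + s) (Q + s)),
      sum_choose_succ_mul
        (fun s t => (-1) ^ t * betaNat (A + t) (C + s) * g G (Q + (t : ℕ)))]
    have h1 : ∑ s ∈ range (P + 1), (P.choose s : ℚ) * ((-1) ^ (s + 1) * betaNat (A + (s + 1)) C *
          g (G + (s + 1)) (Q + (s + 1 : ℕ))) =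
        -∑ s ∈ range (P + 1), (P.choose s : ℚ) *
          ((-1) ^ s * betaNat (A + 1 + s) C * g (G + 1 + s) (Q + 1 + s)) := by
      rw [← sum_neg_distrib]
      refine sum_congr rfl fun s _ => ?_
      rw [show A + (s + 1) = A + 1 + s by ring, show G + (s + 1) = G + 1 + s by ring,
        show Q + ((s + 1 : ℕ) : ℤ) = Q + 1 + s by push_cast; ring]
      ring
    rw [h1, ih A C G Q, ih (A + 1) C (G + 1) (Q + 1), ← sum_neg_distrib, ← sum_add_distrib,
      ← sum_add_distrib]
    refine sum_congr rfl fun s hs => ?_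
    have hs' : s ≤ P := by simpa [Nat.lt_succ_iff] using hs
    obtain ⟨t, rfl⟩ := Nat.exists_eq_add_of_le hs'
    rw [show s + t + 1 - s = t + 1 by lia, show s + t - s = t by lia,
      show Q + 1 + (t : ℤ) = Q + t + 1 by ring, hg,
      show Q + ((t + 1 : ℕ) : ℤ) = Q + t + 1 by push_cast; ring,
      show A + 1 + t = A + t + 1 by ring, ← betaNat_succ_add_succ (A + t) (C + s),
      show A + (t + 1) = A + t + 1 by ring, show C + (s + 1) = C + s + 1 by ring]
    ring

open Finset in
theorem sum_sum_choose_mul_betaNat_mul (A B C D P R G : ℕ) (Q : ℤ) :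
    ∑ s ∈ range (P + 1), ∑ z ∈ range (R + 1), (P.choose s : ℚ) * R.choose z *
        ((-1) ^ (s + z) * betaNat (A + s) C * betaNat (B + z) D *
          intChoose (G + s + z) (Q + s)) =
      ∑ s ∈ range (P + 1), ∑ z ∈ range (R + 1), (P.choose s : ℚ) * R.choose z *
        ((-1) ^ (P - s + (R - z)) * betaNat (A + (P - s)) (C + s) *
          betaNat (B + (R - z)) (D + z) * intChoose G (Q + P - R - s + z)) := by
  have hs (z : ℕ) := sum_choose_mul_betaNat_mul intChoose intChoose_succ_succ P A C (G + z) Q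
  have hz (m : ℤ) := sum_choose_mul_betaNat_mul (fun n m => intChoose n (n - m))
    (fun n m => by simp only [intChoose_symm, intChoose_succ_succ]) R B D G (G - m)
  calc
    _ = ∑ z ∈ range (R + 1), (R.choose z : ℚ) * ((-1) ^ z * betaNat (B + z) D) *
          ∑ s ∈ range (P + 1), (P.choose s : ℚ) *
            ((-1) ^ s * betaNat (A + s) C * intChoose (G + z + s) (Q + s)) := by
      rw [sum_comm]
      refine sum_congr rfl fun z _ => ?_
      rw [mul_sum]
      refine sum_congr rfl fun s _ => ?_
      rw [add_right_comm G s z]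
      ring
    _ = ∑ s ∈ range (P + 1), (P.choose s : ℚ) * ((-1) ^ (P - s) * betaNat (A + (P - s)) (C + s)) *
          ∑ z ∈ range (R + 1), (R.choose z : ℚ) * ((-1) ^ z * betaNat (B + z) D *
            intChoose (G + z) ((G + z : ℕ) - (G - (Q + (P - s : ℕ)) + z))) := by
      simp only [hs, mul_sum]
      rw [sum_comm]
      refine sum_congr rfl fun s _ => sum_congr rfl fun z _ => ?_
      rw [show ((G + z : ℕ) : ℤ) - (G - (Q + (P - s : ℕ)) + z) = Q + (P - s : ℕ) by
        push_cast; ring]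
      ring
    _ = _ := by
      refine sum_congr rfl fun s hs => ?_
      rw [hz, mul_sum]
      refine sum_congr rfl fun z hz => ?_
      have hs' : s ≤ P := by simpa [Nat.lt_succ_iff] using hs
      have hz' : z ≤ R := by simpa [Nat.lt_succ_iff] using hz
      rw [show (G : ℤ) - (G - (Q + (P - s : ℕ)) + (R - z : ℕ)) = Q + P - R - s + z by
        push_cast [hs', hz']; ring]
      ring

open Finset in
theorem finsum_finsum_eq_sum_range {M : Type*} [AddCommMonoid M] (F : ℕ → ℕ → M) (P R : ℕ)
    (hP : ∀ s z, P < s → F s z = 0) (hR : ∀ s z, R < z → F s z = 0) :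
    ∑ᶠ s, ∑ᶠ z, F s z = ∑ s ∈ range (P + 1), ∑ z ∈ range (R + 1), F s z := by
  rw [finsum_eq_sum_of_support_subset (s := range (P + 1))]
  · refine sum_congr rfl fun s _ => finsum_eq_sum_of_support_subset _ fun z hz => ?_
    by_contra h
    exact hz (hR s z (by simpa using h))
  · intro s hs
    by_contra h
    exact hs (by simp [hP s _ (by simpa using h : P < s)])

theorem neg1pw_natCast (n : ℕ) : neg1pw n = (-1) ^ n := by
  simp [neg1pw]

theorem fct_natCast_sub_of_lt {m n : ℕ} (h : m < n) : fct ((m : ℚ) - n) = 0 := by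
  have := fct_intCast_of_neg (show (m - n : ℤ) < 0 by lia)
  exact_mod_cast this

theorem fct_natCast_sub_of_le {m n : ℕ} (h : n ≤ m) :
    fct ((m : ℚ) - n) = Nat.factorial (m - n) := by
  rw [← Nat.cast_sub h, fct_natCast]

/-- The rearrangement formula relating the double-sum expression (stra) for the
stretched SU(2) 9j coefficient with `g = e + f` to the symmetric double-sum
expression (stdK): a rearrangement formula for special Kampé de Fériet
functions. -/
theorem stretched_nineJ_S1_eq_S2 (a b c d e f h k : ℚ)
    (ha : IsNNHalfInt a) (hb : IsNNHalfInt b) (hc : IsNNHalfInt c)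
    (hd : IsNNHalfInt d) (he : IsNNHalfInt e) (hf : IsNNHalfInt f)
    (hh : IsNNHalfInt h) (hk : IsNNHalfInt k)
    (t1 : Triad a b e) (t2 : Triad c d f) (t3 : Triad h k (e + f))
    (t4 : Triad a c h) (t5 : Triad b d k) :
    fct (b + k - d) * fct (b + d + k + 1) * fct (c + h - a) * fct (a + c + h + 1) *
        sumS1 a b c d e f h k =
      fct (h + k - e - f) * sumS2 a b c d e f h k := by
  obtain ⟨⟨A', hA'⟩, -, -⟩ := t1
  obtain ⟨⟨G, hG⟩, -, -⟩ := t3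
  obtain ⟨⟨P, hP⟩, ⟨A, hA⟩, ⟨C, hC⟩⟩ := t4
  obtain ⟨⟨R, hR⟩, ⟨D, hD⟩, ⟨B, hB⟩⟩ := t5
  obtain ⟨Q, hQ⟩ : ∃ Q : ℤ, b - c - e + h = Q := ⟨A' - P, by push_cast; linarith⟩
  have hS1 : sumS1 a b c d e f h k = ∑ s ∈ Finset.range (P + 1), ∑ z ∈ Finset.range (R + 1),
      ((C.factorial * D.factorial * P.factorial * R.factorial : ℚ))⁻¹ *
        ((P.choose s : ℚ) * R.choose z * ((-1) ^ (s + z) * betaNat (A + s) C *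
          betaNat (B + z) D * intChoose (G + s + z) (Q + s))) := by
    unfold sumS1
    rw [finsum_finsum_eq_sum_range _ P R]
    · refine Finset.sum_congr rfl fun s hs => Finset.sum_congr rfl fun z hz => ?_
      have hs' : s ≤ P := by simpa [Nat.lt_succ_iff] using hs
      have hz' : z ≤ R := by simpa [Nat.lt_succ_iff] using hz
      rw [show a - c + h + s = ((A + s : ℕ) : ℚ) by push_cast; linarith,
        show k - b + d + z = ((B + z : ℕ) : ℚ) by push_cast; linarith,
        show h + k - e - f + s + z = ((G + s + z : ℕ) : ℚ) by push_cast; linarith,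
        show a + c - h - s = (P : ℚ) - s by linarith,
        show b + d - k - z = (R : ℚ) - z by linarith,
        show 2 * h + 1 + s = ((A + s + C + 1 : ℕ) : ℚ) by push_cast; linarith,
        show 2 * k + 1 + z = ((B + z + D + 1 : ℕ) : ℚ) by push_cast; linarith,
        show b - c - e + h + s = ((Q + s : ℤ) : ℚ) by push_cast; linarith,
        show k - b + c - f + z = (((G + s + z : ℕ) - (Q + s) : ℤ) : ℚ) by push_cast; linarith,
        fct_natCast_sub_of_le hs', fct_natCast_sub_of_le hz', Nat.cast_choose ℚ hs',
        Nat.cast_choose ℚ hz']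
      simp only [fct_natCast, betaNat, intChoose]
      field_simp
    · intro s z hs
      rw [show a + c - h - s = (P : ℚ) - s by linarith, fct_natCast_sub_of_lt hs]
      simp
    · intro s z hz
      rw [show b + d - k - z = (R : ℚ) - z by linarith, fct_natCast_sub_of_lt hz]
      simp
  have hS2 : (G.factorial : ℚ) * sumS2 a b c d e f h k =
      ∑ s ∈ Finset.range (P + 1), ∑ z ∈ Finset.range (R + 1),
        ((A + C + P + 1).factorial * (B + D + R + 1).factorial *
          (P.factorial * R.factorial : ℚ)⁻¹) *
        ((P.choose s : ℚ) * R.choose z * ((-1) ^ (P - s + (R - z)) *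
          betaNat (A + (P - s)) (C + s) * betaNat (B + (R - z)) (D + z) *
          intChoose G (Q + P - R - s + z))) := by
    unfold sumS2
    rw [finsum_finsum_eq_sum_range _ P R, Finset.mul_sum]
    · refine Finset.sum_congr rfl fun s hs => ?_
      rw [Finset.mul_sum]
      refine Finset.sum_congr rfl fun z hz => ?_
      have hs' : s ≤ P := by simpa [Nat.lt_succ_iff] using hs
      have hz' : z ≤ R := by simpa [Nat.lt_succ_iff] using hz
      rw [show a + b + c + d - h - k + s + z = ((P - s + (R - z) + 2 * (s + z) : ℕ) : ℚ) by
          push_cast [hs', hz']; linarith,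
        show 2 * a - s = ((A + (P - s) : ℕ) : ℚ) by push_cast [hs']; linarith,
        show c + h - a + s = ((C + s : ℕ) : ℚ) by push_cast; linarith,
        show 2 * d - z = ((B + (R - z) : ℕ) : ℚ) by push_cast [hz']; linarith,
        show b - d + k + z = ((D + z : ℕ) : ℚ) by push_cast; linarith,
        show a + c - h - s = (P : ℚ) - s by linarith,
        show b + d - k - z = (R : ℚ) - z by linarith,
        show a - d - e + k - s + z = ((Q + P - R - s + z : ℤ) : ℚ) by push_cast; linarith,
        show d - a - f + h + s - z = ((G - (Q + P - R - s + z) : ℤ) : ℚ) by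
          push_cast; linarith,
        fct_natCast_sub_of_le hs', fct_natCast_sub_of_le hz', Nat.cast_choose ℚ hs',
        Nat.cast_choose ℚ hz', neg1pw_natCast, pow_add (-1 : ℚ) _ (2 * (s + z)), pow_mul,
        neg_one_sq, one_pow]
      simp only [fct_natCast, betaNat, intChoose]
      rw [show A + (P - s) + (C + s) + 1 = A + C + P + 1 by lia,
        show B + (R - z) + (D + z) + 1 = B + D + R + 1 by lia]
      field_simp
    · intro s z hs
      rw [show a + c - h - s = (P : ℚ) - s by linarith, fct_natCast_sub_of_lt hs]
      simp
    · intro s z hz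
      rw [show b + d - k - z = (R : ℚ) - z by linarith, fct_natCast_sub_of_lt hz]
      simp
  rw [show h + k - e - f = (G : ℚ) by linarith, fct_natCast, hS2, hS1,
    show b + k - d = (D : ℚ) by linarith, show c + h - a = (C : ℚ) by linarith,
    show b + d + k + 1 = ((B + D + R + 1 : ℕ) : ℚ) by push_cast; linarith,
    show a + c + h + 1 = ((A + C + P + 1 : ℕ) : ℚ) by push_cast; linarith]
  simp only [fct_natCast, ← Finset.mul_sum]
  rw [sum_sum_choose_mul_betaNat_mul]
  field_simp
end
end
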